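/- Let G = (V,E) be a finite simple graph with adjacency relation Γ, and let |+⟩_V = ⊗_{a∈V} (|0⟩+|1⟩)/√2. Then the state S|+⟩_V, where S = ∏_{(a,b)∈E} S^{ab} is the product of controlled-Z gates over all edges, satisfies for every a ∈ V the eigenvalue equation σ_x^{(a)} ⊗_{b: Γ_{ab}=1} σ_z^{(b)} (S|+⟩_V) = S|+⟩_V. -/

import Mathlib

open Matrix

variable {V : Type*} [Fintype V] [DecidableEq V]

/-- The Pauli operator `σ_x^{(a)}` acting on qubit `a` of `(ℂ²)^{⊗V}`. -/
noncomputable def PX (a : V) : Matrix (V → Fin 2) (V → Fin 2) ℂ :=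
  Matrix.of fun f g => if Function.update f a (g a) = g ∧ f a ≠ g a then 1 else 0

/-- The Pauli operator `σ_z^{(a)}` acting on qubit `a` of `(ℂ²)^{⊗V}`. -/
noncomputable def PZ (a : V) : Matrix (V → Fin 2) (V → Fin 2) ℂ :=
  Matrix.diagonal fun f => if f a = 1 then -1 else 1

lemma PZ_comm (a b : V) : Commute (PZ a) (PZ b) := by
  rw [Commute, SemiconjBy]
  unfold PZ
  rw [Matrix.diagonal_mul_diagonal, Matrix.diagonal_mul_diagonal]
  exact congrArg _ (funext fun i => mul_comm _ _)

/-- The controlled-Z gate `S^{ab}` on qubits `a, b` of `(ℂ²)^{⊗V}`. -/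
noncomputable def CZ (a b : V) : Matrix (V → Fin 2) (V → Fin 2) ℂ :=
  Matrix.diagonal fun f => if f a = 1 ∧ f b = 1 then -1 else 1

lemma CZ_symm (a b : V) : CZ a b = CZ b a := by
  unfold CZ
  congr 1
  funext f
  simp only [and_comm]

/-- The controlled-Z gate associated with an (unordered) edge. -/
noncomputable def CZe : Sym2 V → Matrix (V → Fin 2) (V → Fin 2) ℂ :=
  Sym2.lift ⟨fun a b => CZ a b, fun a b => CZ_symm a b⟩

lemma CZe_comm (e e' : Sym2 V) : Commute (CZe e) (CZe e') := by
  induction e using Sym2.ind with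
  | _ a b =>
    induction e' using Sym2.ind with
    | _ c d =>
      show Commute (CZ a b) (CZ c d)
      rw [Commute, SemiconjBy]
      unfold CZ
      rw [Matrix.diagonal_mul_diagonal, Matrix.diagonal_mul_diagonal]
      exact congrArg _ (funext fun i => mul_comm _ _)

/-- The product state `|+⟩_V = ⊗_{a∈V} (|0⟩+|1⟩)/√2`. -/
noncomputable def plusV : (V → Fin 2) → ℂ :=
  fun _ => (((Real.sqrt 2 : ℝ) : ℂ))⁻¹ ^ Fintype.card V

lemma Finset.noncommProd_diagonal {ι n R : Type*} [Fintype n] [DecidableEq n] [CommSemiring R]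
    (s : Finset ι) (M : ι → Matrix n n R) (d : ι → n → R) (hM : ∀ i, M i = diagonal (d i))
    (comm : ∀ i j, Commute (M i) (M j)) :
    s.noncommProd M (fun i _ j _ _ => comm i j) = diagonal (fun k => ∏ i ∈ s, d i k) := by
  classical
  suffices h : ∀ hs : (s : Set ι).Pairwise (Function.onFun Commute M),
      s.noncommProd M hs = diagonal (fun k => ∏ i ∈ s, d i k) from h _
  induction s using Finset.induction_on with
  | empty => simp
  | insert i s hi ih =>
    intro hs
    rw [Finset.noncommProd_insert_of_notMem _ _ _ _ hi, ih, hM, diagonal_mul_diagonal]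
    simp [Finset.prod_insert hi]

lemma CZe_eq_diagonal (e : Sym2 V) : CZe e = diagonal (fun f => CZe e f f) := by
  induction e using Sym2.ind with
  | _ a b => simp [CZe, CZ]

lemma PX_mulVec_apply (a : V) (v : (V → Fin 2) → ℂ) (f : V → Fin 2) :
    (PX a).mulVec v f = v (Function.update f a (1 - f a)) := by
  have h (g : V → Fin 2) :
      (Function.update f a (g a) = g ∧ f a ≠ g a) ↔ g = Function.update f a (1 - f a) := by
    constructor
    · rintro ⟨h, hne⟩
      have : g a = 1 - f a := by
        generalize f a = x, g a = y at hne
        revert x y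
        decide
      rw [← h, this]
    · rintro rfl
      simp only [Function.update_self, true_and]
      generalize f a = x
      revert x
      decide
  simp [mulVec, dotProduct, PX, h]

lemma CZe_apply_update_of_notMem {a : V} {e : Sym2 V} (h : a ∉ e) (f : V → Fin 2) (x : Fin 2) :
    CZe e (Function.update f a x) (Function.update f a x) = CZe e f f := by
  induction e using Sym2.ind with
  | _ b c =>
    simp only [Sym2.mem_iff, not_or] at h
    simp [CZe, CZ, Function.update_of_ne (Ne.symm h.1), Function.update_of_ne (Ne.symm h.2)]

/-- Flipping qubit `a` changes the sign of the controlled-Z gate on an edge `ab` exactly when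
qubit `b` is set. -/
lemma PZ_mul_CZe_apply_flip {a b : V} (h : a ≠ b) (f : V → Fin 2) :
    PZ b (Function.update f a (1 - f a)) (Function.update f a (1 - f a)) *
      CZe s(a, b) (Function.update f a (1 - f a)) (Function.update f a (1 - f a)) =
    CZe s(a, b) f f := by
  simp only [PZ, CZe, CZ, Sym2.lift_mk, diagonal_apply_eq, Function.update_self,
    Function.update_of_ne h.symm]
  generalize f a = x, f b = y
  fin_cases x <;> fin_cases y <;> simp

lemma SimpleGraph.prod_edgeFinset_eq_prod_neighborFinset_mul {M : Type*} [CommMonoid M]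
    (G : SimpleGraph V) [DecidableRel G.Adj] (a : V) (w : Sym2 V → M) :
    ∏ e ∈ G.edgeFinset, w e =
      (∏ b ∈ G.neighborFinset a, w s(a, b)) * ∏ e ∈ G.edgeFinset with a ∉ e, w e := by
  have h : G.edgeFinset.filter (a ∈ ·) = (G.neighborFinset a).image (s(a, ·)) := by
    ext e
    induction e using Sym2.ind with
    | _ b c =>
      simp only [Finset.mem_filter, mem_edgeFinset, mem_edgeSet, Finset.mem_image,
        mem_neighborFinset, Sym2.mem_iff, Sym2.eq_iff]
      grind [SimpleGraph.adj_comm]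
  rw [← Finset.prod_filter_mul_prod_filter_not _ (a ∈ ·), h,
    Finset.prod_image fun _ _ _ _ => Sym2.congr_right.mp]

/-- For a finite simple graph `G = (V, E)`, the state `S|+⟩_V`, where
`S = ∏_{(a,b)∈E} S^{ab}` is the product of controlled-Z gates over all edges,
satisfies for every `a ∈ V` the graph-state eigenvalue equation
`σ_x^{(a)} ⊗_{b : Γ_{ab}=1} σ_z^{(b)} (S|+⟩_V) = S|+⟩_V`. -/
theorem graph_state_eigenvalue_equation
    (G : SimpleGraph V) [DecidableRel G.Adj] (a : V) :
    (PX a * (G.neighborFinset a).noncommProd PZ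
        (fun x _ y _ _ => PZ_comm x y)).mulVec
      ((G.edgeFinset.noncommProd CZe (fun x _ y _ _ => CZe_comm x y)).mulVec plusV) =
    (G.edgeFinset.noncommProd CZe (fun x _ y _ _ => CZe_comm x y)).mulVec plusV := by
  rw [Finset.noncommProd_diagonal _ PZ (fun b f => PZ b f f) (fun b => by simp [PZ]) PZ_comm,
    Finset.noncommProd_diagonal _ CZe (fun e f => CZe e f f) CZe_eq_diagonal CZe_comm,
    ← mulVec_mulVec]
  ext f
  rw [PX_mulVec_apply]
  simp only [mulVec_diagonal, G.prod_edgeFinset_eq_prod_neighborFinset_mul a]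
  simp only [plusV, ← mul_assoc, ← Finset.prod_mul_distrib]
  congr 2
  · exact Finset.prod_congr rfl fun b hb =>
      PZ_mul_CZe_apply_flip ((G.mem_neighborFinset a b).mp hb).ne f
  · exact Finset.prod_congr rfl fun e he =>
      CZe_apply_update_of_notMem (Finset.mem_filter.mp he).2 f _
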